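/- (Axiomatization of contractive valuation congruence) For all propositional statements P and Q: CP_cr ⊢ P = Q if and only if P =_cr Q, where CP_cr is CP extended with the axiom schemes (CPcr1) (x◁a▷y)◁a▷z = x◁a▷z and (CPcr2) x◁a▷(y◁a▷z) = x◁a▷z for all a ∈ A. -/

import Mathlib

/-- Propositional statements over atoms `A`: constants `T`, `F`, an atom `a`
for each `a ∈ A`, and the ternary conditional composition
`cond x y z = x ◁ y ▷ z` (with `y` the central condition). -/
inductive PS (A : Type) : Type where
  | tt : PS A
  | ff : PS A
  | atom : A → PS A
  | cond : PS A → PS A → PS A → PS A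

/-- A valuation algebra (VA) over `A`. -/
structure VA (A : Type) where
  Val : Type
  Tv : Val
  Fv : Val
  yd : A → Val → Bool
  dv : A → Val → Val
  yd_T : ∀ a, yd a Tv = true
  yd_F : ∀ a, yd a Fv = false
  dv_T : ∀ a, dv a Tv = Tv
  dv_F : ∀ a, dv a Fv = Fv

variable {A : Type}

mutual
  /-- Evaluation `P/H` of a propositional statement over a valuation `H`. -/
  def PS.eval (V : VA A) : PS A → V.Val → Bool
    | .tt, _ => true
    | .ff, _ => false
    | .atom a, H => V.yd a H
    | .cond p q r, H =>
        if PS.eval V q H then PS.eval V p (PS.deriv V q H)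
        else PS.eval V r (PS.deriv V q H)
  /-- The generalized derivative `∂_P(H)`. -/
  def PS.deriv (V : VA A) : PS A → V.Val → V.Val
    | .tt, H => H
    | .ff, H => H
    | .atom a, H => V.dv a H
    | .cond p q r, H =>
        if PS.eval V q H then PS.deriv V p (PS.deriv V q H)
        else PS.deriv V r (PS.deriv V q H)
end

/-- `K`-equivalence: equal evaluation results in all members of the class `K`. -/
def KEquiv (K : VA A → Prop) (P Q : PS A) : Prop :=
  ∀ V : VA A, K V → ∀ H : V.Val, PS.eval V P H = PS.eval V Q H

/-- A congruence with respect to conditional composition. -/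
def IsCondCongruence (R : PS A → PS A → Prop) : Prop :=
  Equivalence R ∧
    ∀ ⦃x x' y y' z z' : PS A⦄, R x x' → R y y' → R z z' →
      R (PS.cond x y z) (PS.cond x' y' z')

/-- `K`-congruence: the largest congruence contained in `K`-equivalence. -/
def KCong (K : VA A → Prop) (P Q : PS A) : Prop :=
  ∃ R : PS A → PS A → Prop,
    IsCondCongruence R ∧ (∀ x y, R x y → KEquiv K x y) ∧ R P Q

/-- Derivability (of closed equations) in equational logic from the axioms `CP`
together with an additional set `Ax` of equational axioms. -/
inductive Deriv (Ax : PS A → PS A → Prop) : PS A → PS A → Prop where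
  | ax {p q} : Ax p q → Deriv Ax p q
  | cp1 (x y) : Deriv Ax (.cond x .tt y) x
  | cp2 (x y) : Deriv Ax (.cond x .ff y) y
  | cp3 (x) : Deriv Ax (.cond .tt x .ff) x
  | cp4 (x y z u v) :
      Deriv Ax (.cond x (.cond y z u) v)
               (.cond (.cond x y v) z (.cond x u v))
  | refl (x) : Deriv Ax x x
  | symm {p q} : Deriv Ax p q → Deriv Ax q p
  | trans {p q r} : Deriv Ax p q → Deriv Ax q r → Deriv Ax p r
  | congr {x x' y y' z z'} : Deriv Ax x x' → Deriv Ax y y' → Deriv Ax z z' →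
      Deriv Ax (.cond x y z) (.cond x' y' z')

/-- No additional axioms: plain `CP`. -/
def NoAx : PS A → PS A → Prop := fun _ _ => False

/-- The class `fr` of free valuation algebras: all VAs. -/
def frK : VA A → Prop := fun _ => True

/-- The class `rp` of repetition-proof VAs. -/
def rpK (V : VA A) : Prop :=
  ∀ (a : A) (x : V.Val), V.yd a x = V.yd a (V.dv a x)

/-- The class `cr` of contractive VAs. -/
def crK (V : VA A) : Prop :=
  rpK V ∧ ∀ (a : A) (x : V.Val), V.dv a (V.dv a x) = V.dv a x

/-- The class `wm` of weakly memorizing VAs. -/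
def wmK (V : VA A) : Prop :=
  crK V ∧ ∀ (a b : A) (x : V.Val),
    V.yd b (V.dv a x) = V.yd a x →
      V.dv a (V.dv b (V.dv a x)) = V.dv b (V.dv a x) ∧
      V.yd a (V.dv b (V.dv a x)) = V.yd a x

/-- The class `mem` of memorizing VAs. -/
def memK (V : VA A) : Prop :=
  crK V ∧ ∀ (a b : A) (x : V.Val),
    V.dv a (V.dv b (V.dv a x)) = V.dv b (V.dv a x) ∧
    V.yd a (V.dv b (V.dv a x)) = V.yd a x

/-- The class `st` of static VAs. -/
def stK (V : VA A) : Prop :=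
  ∀ (a b : A) (x : V.Val), V.yd a (V.dv b x) = V.yd a x

/-- The axiom schemes `(CPcr1)` and `(CPcr2)` (for `a ∈ A`). -/
inductive CrAx {A : Type} : PS A → PS A → Prop where
  | cr1 (a : A) (x y z : PS A) :
      CrAx (.cond (.cond x (.atom a) y) (.atom a) z)
           (.cond x (.atom a) z)
  | cr2 (a : A) (x y z : PS A) :
      CrAx (.cond x (.atom a) (.cond y (.atom a) z))
           (.cond x (.atom a) z)

/-! ### Soundness -/

/-- Equal evaluations and equal derivatives in every member of the class `K`. -/
def SameBehaviour (K : VA A → Prop) (P Q : PS A) : Prop :=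
  ∀ V : VA A, K V → ∀ H : V.Val, P.eval V H = Q.eval V H ∧ P.deriv V H = Q.deriv V H

theorem SameBehaviour.isCondCongruence (K : VA A → Prop) :
    IsCondCongruence (SameBehaviour K) := by
  refine ⟨⟨fun P V _ H => ⟨rfl, rfl⟩, fun h V hV H => ?_, fun h₁ h₂ V hV H => ?_⟩, ?_⟩
  · exact ⟨(h V hV H).1.symm, (h V hV H).2.symm⟩
  · exact ⟨(h₁ V hV H).1.trans (h₂ V hV H).1, (h₁ V hV H).2.trans (h₂ V hV H).2⟩
  · intro x x' y y' z z' hx hy hz V hV H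
    simp only [PS.eval, PS.deriv, (hy V hV H).1, (hy V hV H).2,
      (hx V hV _).1, (hx V hV _).2, (hz V hV _).1, (hz V hV _).2, and_self]

theorem CrAx.sameBehaviour {P Q : PS A} (h : CrAx P Q) : SameBehaviour crK P Q := by
  intro V hV H
  cases h with
  | cr1 a x y z =>
    cases h : V.yd a H <;> simp [PS.eval, PS.deriv, hV.2 a H, ← hV.1 a H, h]
  | cr2 a x y z =>
    cases h : V.yd a H <;> simp [PS.eval, PS.deriv, hV.2 a H, ← hV.1 a H, h]

theorem Deriv.sameBehaviour {Ax : PS A → PS A → Prop} {K : VA A → Prop}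
    (hAx : ∀ P Q, Ax P Q → SameBehaviour K P Q) {P Q : PS A} (h : Deriv Ax P Q) :
    SameBehaviour K P Q := by
  have hc := SameBehaviour.isCondCongruence K
  induction h with
  | ax h => exact hAx _ _ h
  | cp1 x y => intro V _ H; simp [PS.eval, PS.deriv]
  | cp2 x y => intro V _ H; simp [PS.eval, PS.deriv]
  | cp3 x => intro V _ H; simp [PS.eval, PS.deriv]
  | cp4 x y z u v =>
    intro V _ H
    cases h : z.eval V H <;> simp [PS.eval, PS.deriv, h]
  | refl x => exact hc.1.refl x
  | symm _ ih => exact hc.1.symm ih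
  | trans _ _ ih₁ ih₂ => exact hc.1.trans ih₁ ih₂
  | congr _ _ _ ih₁ ih₂ ih₃ => exact hc.2 ih₁ ih₂ ih₃

/-! ### Histories

A history lists the atoms evaluated so far together with their replies, most recent first;
a repeated query of the most recent atom leaves the history unchanged. -/

open Classical in
/-- Query the atom `a` at history `h`, with fresh replies given by `f`. -/
noncomputable def query (f : List (A × Bool) → A → Bool) (a : A) (h : List (A × Bool)) :
    Bool × List (A × Bool) :=
  if (a, true) ∈ h.head? then (true, h)
  else if (a, false) ∈ h.head? then (false, h)
  else (f h a, (a, f h a) :: h)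

theorem query_of_fresh (f : List (A × Bool) → A → Bool) {a : A} {h : List (A × Bool)}
    (ha : ∀ b, (a, b) ∉ h.head?) : query f a h = (f h a, (a, f h a) :: h) := by
  simp [query, if_neg (ha true), if_neg (ha false)]

theorem query_eq_of_mem_head? (f : List (A × Bool) → A → Bool) {a : A} {b : Bool}
    {h : List (A × Bool)} (ha : (a, b) ∈ h.head?) : query f a h = (b, h) := by
  cases b with
  | true => simp [query, if_pos ha]
  | false =>
    have hn : (a, true) ∉ h.head? := fun h' => by simpa using Option.mem_unique h' ha
    simp only [query, if_neg hn, if_pos ha]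

theorem query_query (f : List (A × Bool) → A → Bool) (a : A) (h : List (A × Bool)) :
    query f a (query f a h).2 = query f a h := by
  by_cases ha : ∃ b, (a, b) ∈ h.head?
  · obtain ⟨b, hb⟩ := ha
    simp only [query_eq_of_mem_head? f hb]
  · rw [query_of_fresh f (not_exists.1 ha), query_eq_of_mem_head? f (b := f h a) (by simp)]

/-- The reply of a propositional statement at a history, and the resulting history. -/
noncomputable def PS.run (f : List (A × Bool) → A → Bool) :
    PS A → List (A × Bool) → Bool × List (A × Bool)
  | .tt, h => (true, h)
  | .ff, h => (false, h)
  | .atom a, h => query f a h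
  | .cond p q r, h =>
      if (PS.run f q h).1 then PS.run f p (PS.run f q h).2 else PS.run f r (PS.run f q h).2

/-- The valuation algebra of histories with fresh replies given by `f`; the two additional
points are `T_Val` and `F_Val`. -/
noncomputable def historyVA (f : List (A × Bool) → A → Bool) : VA A where
  Val := List (A × Bool) ⊕ Bool
  Tv := .inr true
  Fv := .inr false
  yd a := Sum.elim (fun h => (query f a h).1) id
  dv a := Sum.map (fun h => (query f a h).2) id
  yd_T _ := rfl
  yd_F _ := rfl
  dv_T _ := rfl
  dv_F _ := rfl

theorem crK_historyVA (f : List (A × Bool) → A → Bool) : crK (historyVA f) := by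
  refine ⟨fun a x => ?_, fun a x => ?_⟩ <;> rcases x with h | b <;>
    simp [historyVA, query_query]

theorem eval_deriv_historyVA (f : List (A × Bool) → A → Bool) (P : PS A)
    (h : List (A × Bool)) :
    P.eval (historyVA f) (.inl h) = (P.run f h).1 ∧
      P.deriv (historyVA f) (.inl h) = .inl (P.run f h).2 := by
  induction P generalizing h with
  | tt => exact ⟨by simp [PS.eval, PS.run], by simp only [PS.deriv, PS.run]; rfl⟩
  | ff => exact ⟨by simp [PS.eval, PS.run], by simp only [PS.deriv, PS.run]; rfl⟩
  | atom a => simp [PS.eval, PS.deriv, PS.run, historyVA]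
  | cond p q r ihp ihq ihr =>
    simp only [PS.eval, PS.deriv, PS.run, (ihq h).1, (ihq h).2]
    split_ifs
    · exact ihp _
    · exact ihr _

theorem SameBehaviour.run_eq {P Q : PS A} (hPQ : SameBehaviour crK P Q)
    (f : List (A × Bool) → A → Bool) (h : List (A × Bool)) : P.run f h = Q.run f h := by
  have := hPQ _ (crK_historyVA f) (.inl h)
  rw [(eval_deriv_historyVA f P h).1, (eval_deriv_historyVA f P h).2,
    (eval_deriv_historyVA f Q h).1, (eval_deriv_historyVA f Q h).2] at this
  exact Prod.ext this.1 (Sum.inl_injective this.2)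

theorem suffix_run (f : List (A × Bool) → A → Bool) (P : PS A) (h : List (A × Bool)) :
    h <:+ (P.run f h).2 := by
  induction P generalizing h with
  | tt => exact List.suffix_rfl
  | ff => exact List.suffix_rfl
  | atom a =>
    simp only [PS.run, query]
    split_ifs
    · exact List.suffix_rfl
    · exact List.suffix_rfl
    · exact List.suffix_cons _ _
  | cond p q r ihp ihq ihr =>
    simp only [PS.run]
    split_ifs
    · exact (ihq h).trans (ihp _)
    · exact (ihq h).trans (ihr _)

/-- Running `P` only consults the fresh replies at histories at least as long as the initial one
and shorter than the final one. -/
theorem run_congr {f g : List (A × Bool) → A → Bool} (P : PS A) (h : List (A × Bool))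
    (hfg : ∀ k, h.length ≤ k.length → k.length < (P.run f h).2.length → f k = g k) :
    P.run f h = P.run g h := by
  induction P generalizing h with
  | tt => rfl
  | ff => rfl
  | atom a =>
    by_cases ha : ∃ b, (a, b) ∈ h.head?
    · obtain ⟨b, hb⟩ := ha
      simp only [PS.run, query_eq_of_mem_head? _ hb]
    · simp only [PS.run, query_of_fresh _ (not_exists.1 ha)] at hfg ⊢
      rw [hfg h le_rfl (by simp)]
  | cond p q r ihp ihq ihr =>
    have hq := (suffix_run f q h).length_le
    have hp := (suffix_run f p (q.run f h).2).length_le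
    have hr := (suffix_run f r (q.run f h).2).length_le
    simp only [PS.run] at hfg ⊢
    split_ifs at hfg with hb
    · rw [← ihq h fun k h₁ h₂ => hfg k h₁ (h₂.trans_le hp), if_pos hb, if_pos hb]
      exact ihp _ fun k h₁ h₂ => hfg k (hq.trans h₁) h₂
    · rw [← ihq h fun k h₁ h₂ => hfg k h₁ (h₂.trans_le hr), if_neg hb, if_neg hb]
      exact ihr _ fun k h₁ h₂ => hfg k (hq.trans h₁) h₂

/-! ### Congruent statements have equal runs -/

theorem exists_fresh [Nontrivial A] (h : List (A × Bool)) : ∃ a, ∀ b, (a, b) ∉ h.head? := by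
  cases h with
  | nil => exact ⟨Classical.arbitrary A, by simp⟩
  | cons x t =>
    obtain ⟨a, ha⟩ := exists_ne x.1
    exact ⟨a, fun b hb => ha (by simp at hb; simp [hb])⟩

/-- If two statements lead to different histories, then a change of the fresh replies at the longer
of the two lets a subsequent atom tell them apart. -/
theorem exists_query_run_ne [Nontrivial A] {f : List (A × Bool) → A → Bool} {P Q : PS A}
    {h : List (A × Bool)} (hne : (P.run f h).2 ≠ (Q.run f h).2)
    (hle : (Q.run f h).2.length ≤ (P.run f h).2.length) :
    ∃ g a, (query g a (P.run g h).2).1 ≠ (query g a (Q.run g h).2).1 := by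
  classical
  obtain ⟨a, ha⟩ := exists_fresh (P.run f h).2
  let g := Function.update f (P.run f h).2 fun _ => !(query f a (Q.run f h).2).1
  have hg : ∀ k ≠ (P.run f h).2, g k = f k := fun k hk => Function.update_of_ne hk _ _
  have hP : P.run f h = P.run g h :=
    run_congr P h fun k _ hk => (hg k fun e => by simp [e] at hk).symm
  have hQ : Q.run f h = Q.run g h :=
    run_congr Q h fun k _ hk => (hg k fun e => by rw [e] at hk; omega).symm
  refine ⟨g, a, ?_⟩
  have hq : query g a (Q.run f h).2 = query f a (Q.run f h).2 := by
    simp only [query, hg _ hne.symm]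
  rw [← hP, ← hQ, hq, query_of_fresh g ha]
  simp [g]

theorem KCong.run_eq [Nontrivial A] {P Q : PS A} (hPQ : KCong crK P Q)
    (f : List (A × Bool) → A → Bool) (h : List (A × Bool)) : P.run f h = Q.run f h := by
  obtain ⟨R, ⟨hR, hc⟩, hK, hPQ⟩ := hPQ
  have key : ∀ g a, (query g a (P.run g h).2).1 = (query g a (Q.run g h).2).1 := by
    intro g a
    have := hK _ _ (hc (hR.refl (.atom a)) hPQ (hR.refl (.atom a))) _ (crK_historyVA g) (.inl h)
    rw [(eval_deriv_historyVA g _ h).1, (eval_deriv_historyVA g _ h).1] at this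
    simpa only [PS.run, ite_self] using this
  refine Prod.ext ?_ ?_
  · have := hK _ _ hPQ _ (crK_historyVA f) (.inl h)
    rwa [(eval_deriv_historyVA f P h).1, (eval_deriv_historyVA f Q h).1] at this
  · by_contra hne
    rcases le_total (Q.run f h).2.length (P.run f h).2.length with hle | hle
    · obtain ⟨g, a, hga⟩ := exists_query_run_ne hne hle
      exact hga (key g a)
    · obtain ⟨g, a, hga⟩ := exists_query_run_ne (Ne.symm hne) hle
      exact hga (key g a).symm

/-! ### Basic forms -/

/-- Basic forms: binary trees with atoms at the inner nodes and truth values at the leaves. -/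
inductive BasicForm (A : Type) : Type where
  | leaf : Bool → BasicForm A
  | node : A → BasicForm A → BasicForm A → BasicForm A

namespace BasicForm

/-- The propositional statement denoted by a basic form. -/
def toPS : BasicForm A → PS A
  | leaf true => .tt
  | leaf false => .ff
  | node a l r => .cond l.toPS (.atom a) r.toPS

/-- Replace the leaves `true` by `x` and the leaves `false` by `y`. -/
def subst : BasicForm A → BasicForm A → BasicForm A → BasicForm A
  | leaf true, x, _ => x
  | leaf false, _, y => y
  | node a l r, x, y => node a (l.subst x y) (r.subst x y)

theorem deriv_subst (Ax : PS A → PS A → Prop) (x y t : BasicForm A) :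
    Deriv Ax (.cond x.toPS t.toPS y.toPS) (t.subst x y).toPS := by
  induction t with
  | leaf b =>
    cases b
    · exact .cp2 _ _
    · exact .cp1 _ _
  | node a l r ihl ihr => exact (Deriv.cp4 _ _ _ _ _).trans (.congr ihl (.refl _) ihr)

theorem exists_deriv (Ax : PS A → PS A → Prop) (P : PS A) :
    ∃ t : BasicForm A, Deriv Ax P t.toPS := by
  induction P with
  | tt => exact ⟨leaf true, .refl _⟩
  | ff => exact ⟨leaf false, .refl _⟩
  | atom a => exact ⟨node a (leaf true) (leaf false), .symm (.cp3 _)⟩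
  | cond p q r ihp ihq ihr =>
    obtain ⟨x, hx⟩ := ihp
    obtain ⟨t, ht⟩ := ihq
    obtain ⟨y, hy⟩ := ihr
    exact ⟨t.subst x y, (Deriv.congr hx ht hy).trans (deriv_subst Ax x y t)⟩

open Classical in
/-- Remove repeated queries from a basic form, where `o` is the preceding query and its reply. -/
noncomputable def contract : Option (A × Bool) → BasicForm A → BasicForm A
  | _, leaf b => leaf b
  | o, node a l r =>
      if o = some (a, true) then l.contract o
      else if o = some (a, false) then r.contract o
      else node a (l.contract (some (a, true))) (r.contract (some (a, false)))

/-- No atom is queried directly after itself, where `o` is the preceding atom. -/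
def IsContracted : Option A → BasicForm A → Prop
  | _, leaf _ => True
  | o, node a l r => o ≠ some a ∧ l.IsContracted (some a) ∧ r.IsContracted (some a)

theorem isContracted_contract (t : BasicForm A) (o : Option (A × Bool)) :
    (t.contract o).IsContracted (o.map Prod.fst) := by
  induction t generalizing o with
  | leaf b => trivial
  | node a l r ihl ihr =>
    simp only [contract]
    split_ifs with h₁ h₂
    · exact ihl o
    · exact ihr o
    · refine ⟨?_, ihl (some (a, true)), ihr (some (a, false))⟩
      rcases o with _ | ⟨b, _ | _⟩ <;> simp_all

theorem deriv_contract_some (t : BasicForm A) (a : A) (z : PS A) :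
    Deriv CrAx (.cond t.toPS (.atom a) z)
        (.cond (t.contract (some (a, true))).toPS (.atom a) z) ∧
      Deriv CrAx (.cond z (.atom a) t.toPS)
        (.cond z (.atom a) (t.contract (some (a, false))).toPS) := by
  induction t generalizing a z with
  | leaf b => exact ⟨.refl _, .refl _⟩
  | node b l r ihl ihr =>
    by_cases hab : a = b
    · subst hab
      simp only [contract, toPS, if_true, Option.some.injEq, Prod.mk.injEq, true_and,
        Bool.false_eq_true, if_false]
      exact ⟨(Deriv.ax (.cr1 _ _ _ _)).trans (ihl a z).1,
        (Deriv.ax (.cr2 _ _ _ _)).trans (ihr a z).2⟩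
    · have h := (ihl b r.toPS).1.trans (ihr b (l.contract (some (b, true))).toPS).2
      simp only [contract, toPS, Option.some.injEq, Prod.mk.injEq, hab, false_and, if_false]
      exact ⟨.congr h (.refl _) (.refl _), .congr (.refl _) (.refl _) h⟩

theorem deriv_contract_none (t : BasicForm A) :
    Deriv CrAx t.toPS (t.contract none).toPS := by
  cases t with
  | leaf b => exact .refl _
  | node b l r =>
    simpa only [contract, toPS, reduceCtorEq, if_false] using
      (deriv_contract_some l b r.toPS).1.trans
        (deriv_contract_some r b (l.contract (some (b, true))).toPS).2

theorem run_leaf (f : List (A × Bool) → A → Bool) (b : Bool) (h : List (A × Bool)) :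
    (leaf b : BasicForm A).toPS.run f h = (b, h) := by
  cases b <;> rfl

theorem run_node (f : List (A × Bool) → A → Bool) {a : A} (l r : BasicForm A)
    {h : List (A × Bool)} (ha : h.head?.map Prod.fst ≠ some a) :
    (node a l r).toPS.run f h =
      if f h a then l.toPS.run f ((a, true) :: h) else r.toPS.run f ((a, false) :: h) := by
  have hfresh : ∀ b, (a, b) ∉ h.head? := fun b hb => ha (by simp [Option.mem_def.1 hb])
  simp only [toPS, PS.run, query_of_fresh f hfresh]
  cases f h a <;> rfl

theorem suffix_run_node (f : List (A × Bool) → A → Bool) {a : A} (l r : BasicForm A)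
    {h : List (A × Bool)} (ha : h.head?.map Prod.fst ≠ some a) :
    (a, f h a) :: h <:+ ((node a l r).toPS.run f h).2 := by
  rw [run_node f l r ha]
  cases f h a
  · exact suffix_run _ _ _
  · exact suffix_run _ _ _

theorem run_update_cons [DecidableEq (List (A × Bool))] (f : List (A × Bool) → A → Bool)
    (v : A → Bool) (P : PS A) (x : A × Bool) (h : List (A × Bool)) :
    P.run (Function.update f h v) (x :: h) = P.run f (x :: h) :=
  run_congr P _ fun k hk _ => Function.update_of_ne (fun e => by simp [e] at hk) _ _

/-- A contracted basic form is determined by its runs. -/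
theorem eq_of_run_eq {t u : BasicForm A} {h : List (A × Bool)}
    (ht : t.IsContracted (h.head?.map Prod.fst)) (hu : u.IsContracted (h.head?.map Prod.fst))
    (heq : ∀ f, t.toPS.run f h = u.toPS.run f h) : t = u := by
  classical
  induction t generalizing u h with
  | leaf b =>
    have e := heq fun _ _ => true
    rw [run_leaf] at e
    cases u with
    | leaf c => rw [run_leaf] at e; rw [(Prod.mk.inj e).1]
    | node c l r =>
      have := (suffix_run_node (fun _ _ => true) l r hu.1).length_le
      simp [← e] at this
  | node a l r ihl ihr =>
    cases u with
    | leaf c =>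
      have e := heq fun _ _ => true
      have := (suffix_run_node (fun _ _ => true) l r ht.1).length_le
      simp [e, run_leaf] at this
    | node c l' r' =>
      have hac : a = c := by
        have h₁ := suffix_run_node (fun _ _ => true) l r ht.1
        have h₂ := suffix_run_node (fun _ _ => true) l' r' hu.1
        rw [heq] at h₁
        have := (List.suffix_of_suffix_length_le h₁ h₂ (by simp)).eq_of_length (by simp)
        simpa using this
      subst hac
      have hl : l = l' := ihl (h := (a, true) :: h) ht.2.1 hu.2.1 fun f => by
        simpa [run_node _ _ _ ht.1, run_update_cons] using
          heq (Function.update f h fun _ => true)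
      have hr : r = r' := ihr (h := (a, false) :: h) ht.2.2 hu.2.2 fun f => by
        simpa [run_node _ _ _ ht.1, run_update_cons] using
          heq (Function.update f h fun _ => false)
      rw [hl, hr]

end BasicForm

theorem exists_deriv_isContracted (P : PS A) :
    ∃ t : BasicForm A, t.IsContracted none ∧ Deriv CrAx P t.toPS := by
  obtain ⟨t, ht⟩ := BasicForm.exists_deriv CrAx P
  exact ⟨t.contract none, t.isContracted_contract none, ht.trans t.deriv_contract_none⟩

/-- **Axiomatization of contractive valuation congruence**:
`CP_cr ⊢ P = Q` if and only if `P =_cr Q`. -/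
theorem cp_cr_axiomatization {A : Type} [Countable A] [Nontrivial A]
    (P Q : PS A) : Deriv CrAx P Q ↔ KCong crK P Q := by
  refine ⟨fun h => ⟨SameBehaviour crK, SameBehaviour.isCondCongruence crK,
    fun x y hxy V hV H => (hxy V hV H).1, h.sameBehaviour fun _ _ => CrAx.sameBehaviour⟩,
    fun h => ?_⟩
  obtain ⟨t, ht, hPt⟩ := exists_deriv_isContracted P
  obtain ⟨u, hu, hQu⟩ := exists_deriv_isContracted Q
  have htu : t = u := BasicForm.eq_of_run_eq (h := []) ht hu fun f => by
    rw [← (hPt.sameBehaviour fun _ _ => CrAx.sameBehaviour).run_eq f [],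
      ← (hQu.sameBehaviour fun _ _ => CrAx.sameBehaviour).run_eq f [], h.run_eq f []]
  exact hPt.trans (htu ▸ hQu.symm)
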